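/- Let n ≥ 3 and let P be the normalized (n−1)-dimensional Hausdorff probability measure on S^{n−1} ⊂ ℝⁿ. The set D of those s ∈ (0,1) for which there exists a continuous odd function F : S^{n−1} → ℝ, not identically zero, with ∫_{C_s(u)} F dP = 0 for every unit vector u, is dense in the interval (0,1). -/

import Mathlib

open MeasureTheory Metric
open scoped RealInnerProductSpace

/-- The normalized `(n-1)`-dimensional Hausdorff probability measure on the unit sphere
`S^{n-1} ⊂ ℝⁿ`. -/
noncomputable def sphereMeasure (n : ℕ) :
    Measure (sphere (0 : EuclideanSpace ℝ (Fin n)) 1) :=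
  (μH[(n : ℝ) - 1] (Set.univ : Set (sphere (0 : EuclideanSpace ℝ (Fin n)) 1)))⁻¹ •
    μH[(n : ℝ) - 1]

/-- The spherical cap `C_s(w) = {v ∈ S^{n-1} : w ⬝ v ≥ s}`. -/
def cap (n : ℕ) (s : ℝ) (w : sphere (0 : EuclideanSpace ℝ (Fin n)) 1) :
    Set (sphere (0 : EuclideanSpace ℝ (Fin n)) 1) :=
  {v | s ≤ ⟪(w : EuclideanSpace ℝ (Fin n)), (v : EuclideanSpace ℝ (Fin n))⟫}

/-- The normalization makes the measure finite, whatever the value of the Hausdorff measure. -/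
instance isFiniteMeasure_sphereMeasure (n : ℕ) : IsFiniteMeasure (sphereMeasure n) := by
  refine ⟨?_⟩
  rw [sphereMeasure, Measure.smul_apply, smul_eq_mul]
  exact lt_of_le_of_lt (ENNReal.inv_mul_le_one _) ENNReal.one_lt_top

/-- The sphere measure is invariant under linear isometries. -/
theorem integral_comp_linearIsometryEquiv {G : Type*} [NormedAddCommGroup G] [NormedSpace ℝ G]
    {n : ℕ} (L : EuclideanSpace ℝ (Fin n) ≃ₗᵢ[ℝ] EuclideanSpace ℝ (Fin n))
    (f : EuclideanSpace ℝ (Fin n) → G) :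
    ∫ v : sphere (0 : EuclideanSpace ℝ (Fin n)) 1, f (L v) ∂(sphereMeasure n) =
      ∫ v : sphere (0 : EuclideanSpace ℝ (Fin n)) 1, f v ∂(sphereMeasure n) := by
  let e : sphere (0 : EuclideanSpace ℝ (Fin n)) 1 ≃ᵢ sphere (0 : EuclideanSpace ℝ (Fin n)) 1 :=
    { toFun := fun v => ⟨L v, by simp⟩
      invFun := fun v => ⟨L.symm v, by simp⟩
      left_inv := fun v => by simp
      right_inv := fun v => by simp
      isometry_toFun := fun v w => by
        simp only [Subtype.edist_eq]
        exact L.isometry v w }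
  have hmap : Measure.map e.toHomeomorph.toMeasurableEquiv (sphereMeasure n) =
      sphereMeasure n := by
    rw [sphereMeasure, Measure.map_smul]
    congr 1
    exact e.map_hausdorffMeasure _
  have h := integral_map_equiv (μ := sphereMeasure n) e.toHomeomorph.toMeasurableEquiv
    (fun v : sphere (0 : EuclideanSpace ℝ (Fin n)) 1 => f v)
  rw [hmap] at h
  exact h.symm

/-- Rotation by the angle `θ` in the coordinate plane `(i, j)`. -/
noncomputable def planeRotation {n : ℕ} (i j : Fin n) (θ : ℝ) (v : EuclideanSpace ℝ (Fin n)) :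
    EuclideanSpace ℝ (Fin n) :=
  v + ((Real.cos θ - 1) * v i - Real.sin θ * v j) • EuclideanSpace.single i (1 : ℝ) +
    (Real.sin θ * v i + (Real.cos θ - 1) * v j) • EuclideanSpace.single j (1 : ℝ)

theorem exists_linearIsometryEquiv_planeRotation {n : ℕ} {i j : Fin n} (hij : i ≠ j) (θ : ℝ) :
    ∃ L : EuclideanSpace ℝ (Fin n) ≃ₗᵢ[ℝ] EuclideanSpace ℝ (Fin n),
      ∀ v, L v = planeRotation i j θ v := by
  let l : EuclideanSpace ℝ (Fin n) →ₗ[ℝ] EuclideanSpace ℝ (Fin n) :=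
    { toFun := planeRotation i j θ
      map_add' := fun v w => by
        simp only [planeRotation, PiLp.add_apply]
        module
      map_smul' := fun c v => by
        simp only [planeRotation, PiLp.smul_apply, smul_eq_mul, RingHom.id_apply]
        module }
  have hl : ∀ v, ‖l v‖ = ‖v‖ := by
    intro v
    rw [← sq_eq_sq₀ (norm_nonneg _) (norm_nonneg _), ← real_inner_self_eq_norm_sq,
      ← real_inner_self_eq_norm_sq]
    change inner ℝ (planeRotation i j θ v) (planeRotation i j θ v) = _
    simp only [planeRotation, inner_add_left, inner_add_right, inner_smul_left, inner_smul_right,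
      EuclideanSpace.inner_single_left, EuclideanSpace.inner_single_right, PiLp.single_apply,
      if_neg hij, if_neg hij.symm]
    simp
    linear_combination (v i ^ 2 + v j ^ 2) * Real.sin_sq_add_cos_sq θ
  exact ⟨(⟨l, hl⟩ : EuclideanSpace ℝ (Fin n) →ₗᵢ[ℝ] _).toLinearIsometryEquiv rfl, fun v => rfl⟩

/-- The generator of the rotations in the coordinate plane `(i, j)`. -/
noncomputable def planeGenerator {n : ℕ} (i j : Fin n) (v : EuclideanSpace ℝ (Fin n)) :
    EuclideanSpace ℝ (Fin n) :=
  (v i) • EuclideanSpace.single j (1 : ℝ) - (v j) • EuclideanSpace.single i (1 : ℝ)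

theorem integral_fderiv_planeGenerator {n : ℕ} {i j : Fin n} (hij : i ≠ j)
    {g : EuclideanSpace ℝ (Fin n) → ℂ} (hg : ContDiff ℝ 1 g) :
    ∫ v : sphere (0 : EuclideanSpace ℝ (Fin n)) 1,
      fderiv ℝ g v (planeGenerator i j v) ∂(sphereMeasure n) = 0 := by
  let D : ℝ → EuclideanSpace ℝ (Fin n) → EuclideanSpace ℝ (Fin n) := fun θ v =>
    (-Real.sin θ * v i - Real.cos θ * v j) • EuclideanSpace.single i (1 : ℝ) +
    (Real.cos θ * v i + -Real.sin θ * v j) • EuclideanSpace.single j (1 : ℝ)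
  have hD : ∀ θ v, HasDerivAt (fun θ => planeRotation i j θ v) (D θ v) θ := by
    intro θ v
    have h1 := ((((Real.hasDerivAt_cos θ).sub_const 1).mul_const (v i)).sub
      ((Real.hasDerivAt_sin θ).mul_const (v j))).smul_const
        (EuclideanSpace.single i (1 : ℝ) : EuclideanSpace ℝ (Fin n))
    have h2 := (((Real.hasDerivAt_sin θ).mul_const (v i)).add
      (((Real.hasDerivAt_cos θ).sub_const 1).mul_const (v j))).smul_const
        (EuclideanSpace.single j (1 : ℝ) : EuclideanSpace ℝ (Fin n))
    exact (h1.const_add v).add h2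
  have hcR : Continuous fun p : ℝ × sphere (0 : EuclideanSpace ℝ (Fin n)) 1 =>
      planeRotation i j p.1 p.2 := by
    unfold planeRotation
    fun_prop
  have hcD : Continuous fun p : ℝ × sphere (0 : EuclideanSpace ℝ (Fin n)) 1 =>
      D p.1 p.2 := by
    fun_prop
  have hcF : Continuous fun p : ℝ × sphere (0 : EuclideanSpace ℝ (Fin n)) 1 =>
      fderiv ℝ g (planeRotation i j p.1 p.2) (D p.1 p.2) :=
    ((hg.continuous_fderiv one_ne_zero).comp hcR).clm_apply hcD
  obtain ⟨C, hC⟩ := ((isCompact_closedBall (0 : ℝ) 1).prod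
    (isCompact_univ (X := sphere (0 : EuclideanSpace ℝ (Fin n)) 1))).exists_bound_of_continuousOn
      hcF.continuousOn
  have hcg : Continuous fun p : ℝ × sphere (0 : EuclideanSpace ℝ (Fin n)) 1 =>
      g (planeRotation i j p.1 p.2) := hg.continuous.comp hcR
  have hsl : ∀ {f : ℝ × sphere (0 : EuclideanSpace ℝ (Fin n)) 1 → ℂ}, Continuous f → ∀ θ,
      Continuous fun v => f (θ, v) := fun hf θ => hf.comp (by fun_prop)
  have key := (hasDerivAt_integral_of_dominated_loc_of_deriv_le (μ := sphereMeasure n)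
    (F := fun θ (v : sphere (0 : EuclideanSpace ℝ (Fin n)) 1) => g (planeRotation i j θ v))
    (F' := fun θ v => fderiv ℝ g (planeRotation i j θ v) (D θ v))
    (x₀ := (0 : ℝ)) (bound := fun _ => C) (Metric.ball_mem_nhds 0 one_pos)
    (Filter.Eventually.of_forall fun θ => (hsl hcg θ).aestronglyMeasurable)
    ((hsl hcg 0).integrable_of_hasCompactSupport (HasCompactSupport.of_compactSpace _))
    (hsl hcF 0).aestronglyMeasurable
    (Filter.Eventually.of_forall fun v θ hθ =>
      hC (θ, v) ⟨Metric.ball_subset_closedBall hθ, Set.mem_univ _⟩)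
    (integrable_const C)
    (Filter.Eventually.of_forall fun v θ _ =>
      ((hg.differentiable one_ne_zero _).hasFDerivAt.comp_hasDerivAt θ (hD θ v)))).2
  have hconst : (fun θ => ∫ v : sphere (0 : EuclideanSpace ℝ (Fin n)) 1,
      g (planeRotation i j θ v) ∂(sphereMeasure n)) =
      fun _ => ∫ v : sphere (0 : EuclideanSpace ℝ (Fin n)) 1, g v ∂(sphereMeasure n) := by
    funext θ
    obtain ⟨L, hL⟩ := exists_linearIsometryEquiv_planeRotation hij θ
    simp only [← hL]
    exact integral_comp_linearIsometryEquiv L g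
  rw [hconst] at key
  have h0 := key.unique (hasDerivAt_const _ _)
  rw [← h0]
  refine integral_congr_ae (Filter.Eventually.of_forall fun v => ?_)
  have hD0 : D 0 v = planeGenerator i j v := by
    simp only [D, planeGenerator, Real.sin_zero, Real.cos_zero]
    module
  have hR0 : planeRotation i j 0 v = v := by simp [planeRotation]
  simp only [hD0, hR0]

/-- Infinitesimal rotation invariance of the sphere measure. -/
theorem integral_eq_zero_of_hasDerivAt {n : ℕ} {i j : Fin n} (hij : i ≠ j)
    {g g' : EuclideanSpace ℝ (Fin n) → ℂ} (hg : ContDiff ℝ 1 g)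
    (hg' : ∀ v, HasDerivAt (fun t : ℝ => g (v + t • planeGenerator i j v)) (g' v) 0) :
    ∫ v : sphere (0 : EuclideanSpace ℝ (Fin n)) 1, g' v ∂(sphereMeasure n) = 0 := by
  rw [← integral_fderiv_planeGenerator hij hg]
  refine integral_congr_ae (Filter.Eventually.of_forall fun v => ?_)
  have h1 : HasDerivAt (fun t : ℝ => (v : EuclideanSpace ℝ (Fin n)) + t • planeGenerator i j v)
      (planeGenerator i j v) 0 := by
    simpa using ((hasDerivAt_id (0 : ℝ)).smul_const (planeGenerator i j
      (v : EuclideanSpace ℝ (Fin n)))).const_add (v : EuclideanSpace ℝ (Fin n))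
  have h2 : HasFDerivAt g (fderiv ℝ g v)
      ((v : EuclideanSpace ℝ (Fin n)) + (0 : ℝ) • planeGenerator i j v) := by
    simpa using (hg.differentiable one_ne_zero (v : EuclideanSpace ℝ (Fin n))).hasFDerivAt
  exact (hg' v).unique (h2.comp_hasDerivAt 0 h1)

/-- The function `φ(v i) (v i + √-1 v j) ^ m`. -/
noncomputable def zonalMulPow {n : ℕ} (i j : Fin n) (φ : ℝ → ℝ) (m : ℕ)
    (v : EuclideanSpace ℝ (Fin n)) : ℂ :=
  (φ (v i) : ℂ) * ((v i : ℂ) + v j * Complex.I) ^ m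

theorem contDiff_coord {n : ℕ} (i : Fin n) :
    ContDiff ℝ 1 fun v : EuclideanSpace ℝ (Fin n) => ((v i : ℝ) : ℂ) :=
  Complex.ofRealCLM.contDiff.comp (contDiff_piLp_apply (𝕜 := ℝ) (p := 2) (i := i))

theorem contDiff_zonalMulPow {n : ℕ} (i j : Fin n) {φ : ℝ → ℝ} (hφ : ContDiff ℝ 1 φ) (m : ℕ) :
    ContDiff ℝ 1 (zonalMulPow i j φ m) :=
  (Complex.ofRealCLM.contDiff.comp
    (hφ.comp (contDiff_piLp_apply (𝕜 := ℝ) (p := 2) (i := i)))).mul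
    (((contDiff_coord i).add ((contDiff_coord j).mul contDiff_const)).pow m)

theorem hasDerivAt_coord {n : ℕ} (i : Fin n) (v w : EuclideanSpace ℝ (Fin n)) :
    HasDerivAt (fun t : ℝ => (((v + t • w) i : ℝ) : ℂ)) (w i) 0 := by
  have h : HasDerivAt (fun t : ℝ => v i + t * w i) (w i) 0 := by
    simpa using ((hasDerivAt_id (0 : ℝ)).mul_const (w i)).const_add (v i)
  simpa using h.ofReal_comp

theorem hasDerivAt_zonalMulPow {n : ℕ} (i j : Fin n) {φ φ' : ℝ → ℝ}
    (hφ : ∀ x, HasDerivAt φ (φ' x) x) (m : ℕ) (v w : EuclideanSpace ℝ (Fin n)) :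
    HasDerivAt (fun t : ℝ => zonalMulPow i j φ m (v + t • w))
      ((φ' (v i) * w i : ℝ) * ((v i : ℂ) + v j * Complex.I) ^ m +
        φ (v i) * (m * ((v i : ℂ) + v j * Complex.I) ^ (m - 1) * (w i + w j * Complex.I))) 0 := by
  have h : HasDerivAt (fun t : ℝ => v i + t * w i) (w i) 0 := by
    simpa using ((hasDerivAt_id (0 : ℝ)).mul_const (w i)).const_add (v i)
  have h1 : HasDerivAt (fun t : ℝ => φ (v i + t * w i)) (φ' (v i) * w i) 0 :=
    HasDerivAt.comp (0 : ℝ) (by simpa using hφ (v i)) h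
  have h2 := ((hasDerivAt_coord i v w).add
    ((hasDerivAt_coord j v w).mul_const Complex.I)).pow m
  have h3 := h1.ofReal_comp.mul h2
  refine (h3.congr_deriv (by simp)).congr_of_eventuallyEq
    (Filter.Eventually.of_forall fun t => ?_)
  simp [zonalMulPow]

theorem hasDerivAt_coord_mul_zonalMulPow {n : ℕ} (i j l : Fin n) {φ φ' : ℝ → ℝ}
    (hφ : ∀ x, HasDerivAt φ (φ' x) x) (m : ℕ) (v w : EuclideanSpace ℝ (Fin n)) :
    HasDerivAt (fun t : ℝ => (((v + t • w) l : ℝ) : ℂ) * zonalMulPow i j φ m (v + t • w))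
      (w l * zonalMulPow i j φ m v +
        v l * ((φ' (v i) * w i : ℝ) * ((v i : ℂ) + v j * Complex.I) ^ m +
        φ (v i) * (m * ((v i : ℂ) + v j * Complex.I) ^ (m - 1) * (w i + w j * Complex.I)))) 0 := by
  have h := (hasDerivAt_coord l v w).mul (hasDerivAt_zonalMulPow i j hφ m v w)
  refine (h.congr_deriv (by simp)).congr_of_eventuallyEq (Filter.Eventually.of_forall fun t => rfl)

/-- Continuous functions are integrable on the sphere. -/
theorem integrable_sphere {n : ℕ} {G : Type*} [NormedAddCommGroup G]
    {f : EuclideanSpace ℝ (Fin n) → G} (hf : Continuous f) :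
    Integrable (fun v : sphere (0 : EuclideanSpace ℝ (Fin n)) 1 => f v) (sphereMeasure n) :=
  (hf.comp continuous_subtype_val).integrable_of_hasCompactSupport
    (HasCompactSupport.of_compactSpace _)

theorem contDiff_one_of_hasDerivAt {φ φ' : ℝ → ℝ} (h : ∀ x, HasDerivAt φ (φ' x) x)
    (hc : Continuous φ') : ContDiff ℝ 1 φ := by
  rw [contDiff_one_iff_deriv]
  refine ⟨fun x => (h x).differentiableAt, ?_⟩
  rwa [show deriv φ = φ' from funext fun x => (h x).deriv]

theorem mul_pow_pred_mul (m : ℕ) (z : ℂ) : (m : ℂ) * z ^ (m - 1) * z = m * z ^ m := by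
  cases m with
  | zero => simp
  | succ m => simp [pow_succ, mul_assoc]

theorem integral_rotation_zonalMulPow {n : ℕ} {i j : Fin n} (hij : i ≠ j) {φ φ' : ℝ → ℝ}
    (hφ : ∀ x, HasDerivAt φ (φ' x) x) (hφ' : Continuous φ') (m : ℕ) :
    ∫ v : sphere (0 : EuclideanSpace ℝ (Fin n)) 1,
      (m * Complex.I * zonalMulPow i j φ m v - v.1 j * zonalMulPow i j φ' m v)
        ∂(sphereMeasure n) = 0 := by
  refine integral_eq_zero_of_hasDerivAt hij
    (g' := fun v => m * Complex.I * zonalMulPow i j φ m v - v j * zonalMulPow i j φ' m v)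
    (contDiff_zonalMulPow i j (contDiff_one_of_hasDerivAt hφ hφ') m) fun v => ?_
  refine (hasDerivAt_zonalMulPow i j hφ m v (planeGenerator i j v)).congr_deriv ?_
  simp only [planeGenerator, zonalMulPow, PiLp.sub_apply, PiLp.smul_apply, PiLp.single_apply,
    if_neg hij, if_neg hij.symm, smul_eq_mul, if_true, mul_zero, mul_one]
  push_cast
  linear_combination (φ (v i) * Complex.I) *
    mul_pow_pred_mul m ((v i : ℂ) + v j * Complex.I) -
    (φ (v i) * m * ((v i : ℂ) + v j * Complex.I) ^ (m - 1) * v j) * Complex.I_sq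

theorem integral_rotation_coord_mul_zonalMulPow {n : ℕ} {i j : Fin n} (hij : i ≠ j) {φ φ' : ℝ → ℝ}
    (hφ : ∀ x, HasDerivAt φ (φ' x) x) (hφ' : Continuous φ') (m : ℕ) :
    ∫ v : sphere (0 : EuclideanSpace ℝ (Fin n)) 1,
      (v.1 i * zonalMulPow i j φ m v + m * Complex.I * (v.1 j * zonalMulPow i j φ m v) -
        (v.1 j : ℂ) ^ 2 * zonalMulPow i j φ' m v) ∂(sphereMeasure n) = 0 := by
  refine integral_eq_zero_of_hasDerivAt hij
    (g := fun v => v j * zonalMulPow i j φ m v)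
    (g' := fun v => v i * zonalMulPow i j φ m v + m * Complex.I * (v j * zonalMulPow i j φ m v) -
        (v j : ℂ) ^ 2 * zonalMulPow i j φ' m v)
    ((contDiff_coord j).mul
      (contDiff_zonalMulPow i j (contDiff_one_of_hasDerivAt hφ hφ') m)) fun v => ?_
  refine (hasDerivAt_coord_mul_zonalMulPow i j j hφ m v (planeGenerator i j v)).congr_deriv ?_
  simp only [planeGenerator, zonalMulPow, PiLp.sub_apply, PiLp.smul_apply, PiLp.single_apply,
    if_neg hij, if_neg hij.symm, smul_eq_mul, if_true, mul_zero, mul_one]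
  push_cast
  linear_combination (φ (v i) * Complex.I * v j) *
    mul_pow_pred_mul m ((v i : ℂ) + v j * Complex.I) -
    (φ (v i) * m * ((v i : ℂ) + v j * Complex.I) ^ (m - 1) * v j ^ 2) * Complex.I_sq

theorem sum_sq_compl {n : ℕ} {i j : Fin n} (hij : i ≠ j) (v : sphere (0 : EuclideanSpace ℝ (Fin n)) 1) :
    ∑ l ∈ {i, j}ᶜ, (v.1 l : ℂ) ^ 2 = 1 - (v.1 i : ℂ) ^ 2 - (v.1 j : ℂ) ^ 2 := by
  have h : ∑ l, (v.1 l) ^ 2 = 1 := by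
    rw [← EuclideanSpace.real_norm_sq_eq]
    simp
  rw [← Finset.sum_add_sum_compl {i, j}, Finset.sum_pair hij] at h
  have h' := congrArg (fun x : ℝ => (x : ℂ)) h
  push_cast at h'
  linear_combination h'

theorem integral_rotation_fst {n : ℕ} {i j : Fin n} (hij : i ≠ j) {φ φ' : ℝ → ℝ}
    (hφ : ∀ x, HasDerivAt φ (φ' x) x) (hφ' : Continuous φ') (m : ℕ) :
    ∫ v : sphere (0 : EuclideanSpace ℝ (Fin n)) 1,
      (((n : ℂ) - 2) * (v.1 i * zonalMulPow i j φ m v) -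
        (1 - (v.1 i : ℂ) ^ 2 - (v.1 j : ℂ) ^ 2) *
          (zonalMulPow i j φ' m v + m * zonalMulPow i j φ (m - 1) v)) ∂(sphereMeasure n) = 0 := by
  have hφc := contDiff_one_of_hasDerivAt hφ hφ'
  have hc := contDiff_zonalMulPow i j hφc
  have hc' : Continuous (zonalMulPow i j φ' m) := by unfold zonalMulPow; fun_prop
  have h : ∀ l ∈ ({i, j}ᶜ : Finset (Fin n)), ∫ v : sphere (0 : EuclideanSpace ℝ (Fin n)) 1,
      (v.1 i * zonalMulPow i j φ m v - (v.1 l : ℂ) ^ 2 *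
        (zonalMulPow i j φ' m v + m * zonalMulPow i j φ (m - 1) v)) ∂(sphereMeasure n) = 0 := by
    intro l hl
    obtain ⟨hli, hlj⟩ : l ≠ i ∧ l ≠ j := by simpa using hl
    refine integral_eq_zero_of_hasDerivAt hli.symm
      (g := fun v => v l * zonalMulPow i j φ m v)
      (g' := fun v => v i * zonalMulPow i j φ m v - (v l : ℂ) ^ 2 *
        (zonalMulPow i j φ' m v + m * zonalMulPow i j φ (m - 1) v))
      ((contDiff_coord l).mul (hc m)) fun v => ?_
    refine (hasDerivAt_coord_mul_zonalMulPow i j l hφ m v (planeGenerator i l v)).congr_deriv ?_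
    simp only [planeGenerator, zonalMulPow, PiLp.sub_apply, PiLp.smul_apply, PiLp.single_apply,
      if_neg hli, if_neg hli.symm, if_neg hlj.symm, if_neg hij.symm,
      smul_eq_mul, if_true, mul_zero, mul_one]
    push_cast
    ring
  have hsum := Finset.sum_eq_zero h
  rw [← integral_finsetSum] at hsum
  · rw [← hsum]
    refine integral_congr_ae (Filter.Eventually.of_forall fun v => ?_)
    have hcard : ((({i, j}ᶜ : Finset (Fin n)).card : ℕ) : ℂ) = n - 2 := by
      rw [Finset.card_compl, Finset.card_pair hij, Nat.cast_sub]
      · simp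
      · rw [← Finset.card_pair hij]; exact Finset.card_le_univ _
    simp only [Finset.sum_sub_distrib, Finset.sum_const, ← Finset.sum_mul, sum_sq_compl hij,
      nsmul_eq_mul, hcard]
  · intro l _
    exact integrable_sphere (f := fun v => v i * zonalMulPow i j φ m v - (v l : ℂ) ^ 2 *
        (zonalMulPow i j φ' m v + m * zonalMulPow i j φ (m - 1) v))
      (((contDiff_coord i).continuous.mul (hc m).continuous).sub
        (((contDiff_coord l).continuous.pow 2).mul
          (hc'.add (continuous_const.mul (hc (m - 1)).continuous))))

theorem integral_rotation_snd {n : ℕ} {i j : Fin n} (hij : i ≠ j) {φ φ' : ℝ → ℝ}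
    (hφ : ∀ x, HasDerivAt φ (φ' x) x) (hφ' : Continuous φ') (m : ℕ) :
    ∫ v : sphere (0 : EuclideanSpace ℝ (Fin n)) 1,
      (((n : ℂ) - 2) * (v.1 j * zonalMulPow i j φ m v) -
        (1 - (v.1 i : ℂ) ^ 2 - (v.1 j : ℂ) ^ 2) *
          (m * Complex.I * zonalMulPow i j φ (m - 1) v)) ∂(sphereMeasure n) = 0 := by
  have hφc := contDiff_one_of_hasDerivAt hφ hφ'
  have hc := contDiff_zonalMulPow i j hφc
  have h : ∀ l ∈ ({i, j}ᶜ : Finset (Fin n)), ∫ v : sphere (0 : EuclideanSpace ℝ (Fin n)) 1,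
      (v.1 j * zonalMulPow i j φ m v - (v.1 l : ℂ) ^ 2 *
        (m * Complex.I * zonalMulPow i j φ (m - 1) v)) ∂(sphereMeasure n) = 0 := by
    intro l hl
    obtain ⟨hli, hlj⟩ : l ≠ i ∧ l ≠ j := by simpa using hl
    refine integral_eq_zero_of_hasDerivAt hlj.symm
      (g := fun v => v l * zonalMulPow i j φ m v)
      (g' := fun v => v j * zonalMulPow i j φ m v - (v l : ℂ) ^ 2 *
        (m * Complex.I * zonalMulPow i j φ (m - 1) v))
      ((contDiff_coord l).mul (hc m)) fun v => ?_
    refine (hasDerivAt_coord_mul_zonalMulPow i j l hφ m v (planeGenerator j l v)).congr_deriv ?_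
    simp only [planeGenerator, zonalMulPow, PiLp.sub_apply, PiLp.smul_apply, PiLp.single_apply,
      if_neg hlj, if_neg hli.symm, if_neg hlj.symm, if_neg hij,
      smul_eq_mul, if_true, mul_zero, mul_one]
    push_cast
    ring
  have hsum := Finset.sum_eq_zero h
  rw [← integral_finsetSum] at hsum
  · rw [← hsum]
    refine integral_congr_ae (Filter.Eventually.of_forall fun v => ?_)
    have hcard : ((({i, j}ᶜ : Finset (Fin n)).card : ℕ) : ℂ) = n - 2 := by
      rw [Finset.card_compl, Finset.card_pair hij, Nat.cast_sub]
      · simp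
      · rw [← Finset.card_pair hij]; exact Finset.card_le_univ _
    simp only [Finset.sum_sub_distrib, Finset.sum_const, ← Finset.sum_mul, sum_sq_compl hij,
      nsmul_eq_mul, hcard]
  · intro l _
    exact integrable_sphere (f := fun v => v j * zonalMulPow i j φ m v - (v l : ℂ) ^ 2 *
        (m * Complex.I * zonalMulPow i j φ (m - 1) v))
      (((contDiff_coord j).continuous.mul (hc m).continuous).sub
        (((contDiff_coord l).continuous.pow 2).mul
          (continuous_const.mul (hc (m - 1)).continuous)))

theorem continuous_coord {n : ℕ} (i : Fin n) :
    Continuous fun v : sphere (0 : EuclideanSpace ℝ (Fin n)) 1 => ((v.1 i : ℝ) : ℂ) := by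
  fun_prop

theorem continuous_zonalMulPow {n : ℕ} (i j : Fin n) {φ : ℝ → ℝ} (hφ : Continuous φ) (m : ℕ) :
    Continuous (zonalMulPow i j φ m) := by
  unfold zonalMulPow
  fun_prop

/-- Weak form of the eigenvalue equation of the spherical Laplacian for `(v i + √-1 v j) ^ (m + 1)`,
tested against zonal functions. -/
theorem integral_laplacian_zonal_mul {n : ℕ} {i j : Fin n} (hij : i ≠ j) {φ φ' φ'' : ℝ → ℝ}
    (hφ : ∀ x, HasDerivAt φ (φ' x) x) (hφ' : ∀ x, HasDerivAt φ' (φ'' x) x)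
    (hφ'' : Continuous φ'') (m : ℕ) :
    ∫ v : sphere (0 : EuclideanSpace ℝ (Fin n)) 1,
      zonalMulPow i j (fun t => (m + 1) * (m + n - 1) * φ t + (1 - t ^ 2) * φ'' t -
        (n - 1) * t * φ' t) (m + 1) v ∂(sphereMeasure n) = 0 := by
  have c' : Continuous φ' := continuous_iff_continuousAt.2 fun x => (hφ' x).continuousAt
  have c : Continuous φ := continuous_iff_continuousAt.2 fun x => (hφ x).continuousAt
  have hz : ∀ {χ : ℝ → ℝ}, Continuous χ → ∀ p,
      Continuous fun v : sphere (0 : EuclideanSpace ℝ (Fin n)) 1 => zonalMulPow i j χ p v :=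
    fun hχ p => (continuous_zonalMulPow i j hχ p).comp continuous_subtype_val
  have hint : ∀ {f : sphere (0 : EuclideanSpace ℝ (Fin n)) 1 → ℂ}, Continuous f →
      Integrable f (sphereMeasure n) := fun hf =>
    hf.integrable_of_hasCompactSupport (HasCompactSupport.of_compactSpace _)
  have ci := continuous_coord i
  have cj := continuous_coord j
  have z0 := fun p => hz c p
  have z1 := fun p => hz c' p
  have z2 := fun p => hz hφ'' p
  have hA := integral_rotation_coord_mul_zonalMulPow hij hφ' hφ'' (m + 1)
  have hB := integral_rotation_fst hij hφ' hφ'' (m + 1)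
  have hC := integral_rotation_fst hij hφ c' m
  have hD := integral_rotation_snd hij hφ c' m
  have hE := integral_rotation_zonalMulPow hij hφ c' (m + 1)
  set A := fun v : sphere (0 : EuclideanSpace ℝ (Fin n)) 1 =>
    v.1 i * zonalMulPow i j φ' (m + 1) v +
      (m + 1 : ℕ) * Complex.I * (v.1 j * zonalMulPow i j φ' (m + 1) v) -
        (v.1 j : ℂ) ^ 2 * zonalMulPow i j φ'' (m + 1) v with dA
  set B := fun v : sphere (0 : EuclideanSpace ℝ (Fin n)) 1 =>
    (((n : ℂ) - 2) * (v.1 i * zonalMulPow i j φ' (m + 1) v) -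
        (1 - (v.1 i : ℂ) ^ 2 - (v.1 j : ℂ) ^ 2) * (zonalMulPow i j φ'' (m + 1) v +
          (m + 1 : ℕ) * zonalMulPow i j φ' (m + 1 - 1) v)) with dB
  set C := fun v : sphere (0 : EuclideanSpace ℝ (Fin n)) 1 =>
    (((n : ℂ) - 2) * (v.1 i * zonalMulPow i j φ m v) -
        (1 - (v.1 i : ℂ) ^ 2 - (v.1 j : ℂ) ^ 2) *
          (zonalMulPow i j φ' m v + m * zonalMulPow i j φ (m - 1) v)) with dC
  set D := fun v : sphere (0 : EuclideanSpace ℝ (Fin n)) 1 =>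
    (((n : ℂ) - 2) * (v.1 j * zonalMulPow i j φ m v) -
        (1 - (v.1 i : ℂ) ^ 2 - (v.1 j : ℂ) ^ 2) *
          (m * Complex.I * zonalMulPow i j φ (m - 1) v)) with dD
  set E := fun v : sphere (0 : EuclideanSpace ℝ (Fin n)) 1 =>
    ((m + 1 : ℕ) * Complex.I * zonalMulPow i j φ (m + 1) v -
      v.1 j * zonalMulPow i j φ' (m + 1) v) with dE
  have iA : Integrable A (sphereMeasure n) := hint (by fun_prop)
  have iB : Integrable B (sphereMeasure n) := hint (by fun_prop)
  have iC : Integrable C (sphereMeasure n) := hint (by fun_prop)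
  have iD : Integrable D (sphereMeasure n) := hint (by fun_prop)
  have iE : Integrable E (sphereMeasure n) := hint (by fun_prop)
  calc
    _ = ∫ v, (((m : ℂ) + 1) * C v + ((m : ℂ) + 1) * Complex.I * D v -
          ((m : ℂ) + 1) * Complex.I * E v - A v - B v) ∂(sphereMeasure n) := by
      refine integral_congr_ae (Filter.Eventually.of_forall fun v => ?_)
      simp only [dA, dB, dC, dD, dE, zonalMulPow, add_tsub_cancel_right]
      push_cast
      have h := Complex.I_sq
      generalize Complex.I = I at *
      generalize ((v.1 i : ℝ) : ℂ) = a
      generalize ((v.1 j : ℝ) : ℂ) = b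
      rw [pow_succ (a + b * I) m]
      generalize (a + b * I) ^ m = w
      generalize (a + b * I) ^ (m - 1) = w'
      linear_combination (((m : ℂ) + 1) * (1 - a ^ 2 - b ^ 2) * m * φ (v.1 i) * w' +
        ((m : ℂ) + 1) ^ 2 * φ (v.1 i) * w * (a + b * I)) * h
    _ = 0 := by
      rw [integral_sub, integral_sub, integral_sub, integral_add, integral_const_mul,
        integral_const_mul, integral_const_mul, hA, hB, hC, hD, hE]
      · simp
      all_goals
        first
        | exact iA
        | exact iB
        | exact hint (by fun_prop)

/-- Parallels of the sphere have measure zero. -/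
theorem sphereMeasure_parallel {n : ℕ} {i j : Fin n} (hij : i ≠ j) {s : ℝ} (hs : s ^ 2 < 1) :
    sphereMeasure n {v | v.1 i = s} = 0 := by
  have hint : ∀ {f : sphere (0 : EuclideanSpace ℝ (Fin n)) 1 → ℝ}, Continuous f →
      Integrable f (sphereMeasure n) := fun hf =>
    hf.integrable_of_hasCompactSupport (HasCompactSupport.of_compactSpace _)
  have hcoord : ∀ v : sphere (0 : EuclideanSpace ℝ (Fin n)) 1, |v.1 i| ≤ 1 := fun v => by
    simpa using PiLp.norm_apply_le v.1 i
  have key : ∀ ε : ℝ, 0 < ε → (1 - s ^ 2) * (sphereMeasure n).real {v | v.1 i = s} ≤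
      ε * (|(n : ℝ) - 1| * (Real.pi / 2) * (sphereMeasure n).real Set.univ) := by
    intro ε hε
    set φ : ℝ → ℝ := fun t => ε * Real.arctan ((t - s) / ε) with dφ
    set φ' : ℝ → ℝ := fun t => 1 / (1 + ((t - s) / ε) ^ 2) with dφ'
    have h : ∀ x, HasDerivAt φ (φ' x) x := fun x => by
      have := ((((hasDerivAt_id x).sub_const s).div_const ε).arctan).const_mul ε
      refine this.congr_deriv ?_
      simp only [dφ', id]
      field_simp
    have c' : Continuous φ' := by
      refine continuous_const.div (by fun_prop) fun x => by positivity
    have c : Continuous φ := continuous_iff_continuousAt.2 fun x => (h x).continuousAt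
    have hA := integral_rotation_coord_mul_zonalMulPow hij h c' 0
    have hB := integral_rotation_fst hij h c' 0
    have hR : ∫ v : sphere (0 : EuclideanSpace ℝ (Fin n)) 1,
        (((n : ℝ) - 1) * (v.1 i * φ (v.1 i)) - (1 - (v.1 i) ^ 2) * φ' (v.1 i))
          ∂(sphereMeasure n) = 0 := by
      rw [← Complex.ofReal_eq_zero, ← integral_complex_ofReal, ← add_zero (0 : ℂ)]
      nth_rw 2 [← hA]
      rw [← hB, ← integral_add]
      · refine integral_congr_ae (Filter.Eventually.of_forall fun v => ?_)
        simp only [zonalMulPow]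
        push_cast
        ring
      all_goals
        refine Continuous.integrable_of_hasCompactSupport ?_
          (HasCompactSupport.of_compactSpace _)
        unfold zonalMulPow
        fun_prop
    rw [integral_sub (hint (by fun_prop)) (hint (by fun_prop)), sub_eq_zero] at hR
    have hmeas : MeasurableSet {v : sphere (0 : EuclideanSpace ℝ (Fin n)) 1 | v.1 i = s} :=
      (isClosed_eq (by fun_prop) continuous_const).measurableSet
    calc (1 - s ^ 2) * (sphereMeasure n).real {v | v.1 i = s}
        = ∫ v in {v : sphere (0 : EuclideanSpace ℝ (Fin n)) 1 | v.1 i = s},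
            (1 - (v.1 i) ^ 2) * φ' (v.1 i) ∂(sphereMeasure n) := by
          rw [setIntegral_congr_fun (g := fun _ => 1 - s ^ 2) hmeas]
          · rw [setIntegral_const, smul_eq_mul, mul_comm]
          · intro v hv
            have hv : v.1 i = s := hv
            simp [hv, dφ']
      _ ≤ ∫ v : sphere (0 : EuclideanSpace ℝ (Fin n)) 1,
            (1 - (v.1 i) ^ 2) * φ' (v.1 i) ∂(sphereMeasure n) := by
          refine setIntegral_le_integral (hint (by fun_prop))
            (Filter.Eventually.of_forall fun v => ?_)
          have := (sq_le_one_iff_abs_le_one _).2 (hcoord v)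
          have h2 : 0 ≤ φ' (v.1 i) := by simp only [dφ']; positivity
          exact mul_nonneg (by linarith) h2
      _ ≤ ∫ v : sphere (0 : EuclideanSpace ℝ (Fin n)) 1,
            |(n : ℝ) - 1| * (ε * (Real.pi / 2)) ∂(sphereMeasure n) := by
          rw [← hR]
          refine integral_mono (hint (by fun_prop)) (integrable_const _) fun v => ?_
          refine (le_abs_self _).trans ?_
          rw [abs_mul, abs_mul]
          refine mul_le_mul_of_nonneg_left ?_ (abs_nonneg _)
          have h1 : |φ (v.1 i)| ≤ ε * (Real.pi / 2) := by
            simp only [dφ]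
            rw [abs_mul, abs_of_pos hε]
            refine mul_le_mul_of_nonneg_left ?_ hε.le
            exact abs_le.2 ⟨(Real.neg_pi_div_two_lt_arctan _).le, (Real.arctan_lt_pi_div_two _).le⟩
          calc |v.1 i| * |φ (v.1 i)| ≤ 1 * |φ (v.1 i)| :=
                mul_le_mul_of_nonneg_right (hcoord v) (abs_nonneg _)
            _ ≤ _ := by rwa [one_mul]
      _ = _ := by
          rw [integral_const, smul_eq_mul]
          ring
  rw [← measureReal_eq_zero_iff]
  have hlim : Filter.Tendsto (fun ε : ℝ => ε *
      (|(n : ℝ) - 1| * (Real.pi / 2) * (sphereMeasure n).real Set.univ))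
      (nhdsWithin 0 (Set.Ioi 0)) (nhds 0) := by
    have : Filter.Tendsto (fun ε : ℝ => ε *
      (|(n : ℝ) - 1| * (Real.pi / 2) * (sphereMeasure n).real Set.univ)) (nhds 0) (nhds (0 * _)) :=
      Filter.Tendsto.mul_const _ Filter.tendsto_id
    rw [zero_mul] at this
    exact this.mono_left nhdsWithin_le_nhds
  have hle := ge_of_tendsto hlim (Filter.eventually_of_mem self_mem_nhdsWithin key)
  have h0 : 0 ≤ (sphereMeasure n).real {v | v.1 i = s} := measureReal_nonneg
  nlinarith

theorem inner_single_one {n : ℕ} (i : Fin n) (v : EuclideanSpace ℝ (Fin n)) :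
    ⟪EuclideanSpace.single i (1 : ℝ), v⟫ = v i := by
  simp [EuclideanSpace.inner_single_left]

theorem exists_linearIsometryEquiv_map_pair {n : ℕ} {i j : Fin n} (hij : i ≠ j)
    {u e : EuclideanSpace ℝ (Fin n)} (hu : ‖u‖ = 1) (he : ‖e‖ = 1) (hue : ⟪u, e⟫ = 0) :
    ∃ L : EuclideanSpace ℝ (Fin n) ≃ₗᵢ[ℝ] EuclideanSpace ℝ (Fin n),
      L (EuclideanSpace.single i 1) = u ∧ L (EuclideanSpace.single j 1) = e := by
  classical
  let w : Fin n → EuclideanSpace ℝ (Fin n) := fun l => if l = i then u else e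
  have hw : Orthonormal ℝ (({i, j} : Set (Fin n)).domRestrict w) := by
    constructor
    · rintro ⟨l, hl⟩
      change ‖(if l = i then u else e)‖ = 1
      split_ifs <;> assumption
    · rintro ⟨l, hl⟩ ⟨l', hl'⟩ hll'
      have hne : l ≠ l' := fun h => hll' (Subtype.ext h)
      clear hll'
      have hue' : ⟪e, u⟫ = 0 := by rw [real_inner_comm, hue]
      change ⟪(if l = i then u else e), (if l' = i then u else e)⟫ = 0
      rcases hl with rfl | rfl <;> rcases hl' with rfl | rfl
      · exact absurd rfl hne
      · rwa [if_pos rfl, if_neg hne.symm]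
      · rwa [if_pos rfl, if_neg hne]
      · exact absurd rfl hne
  obtain ⟨b, hb⟩ := hw.exists_orthonormalBasis_extension_of_card_eq (by simp)
  refine ⟨b.repr.symm, ?_, ?_⟩
  · rw [b.repr_symm_single, hb i (by simp)]
    simp [w]
  · rw [b.repr_symm_single, hb j (by simp)]
    simp [w, hij.symm]

theorem exists_unit_orthogonal_decomposition {n : ℕ} (hn : 2 ≤ n)
    {u : EuclideanSpace ℝ (Fin n)} (hu : ‖u‖ = 1) (ξ : EuclideanSpace ℝ (Fin n)) :
    ∃ (e : EuclideanSpace ℝ (Fin n)) (ρ : ℝ), ‖e‖ = 1 ∧ ⟪u, e⟫ = 0 ∧ ξ = ⟪u, ξ⟫ • u + ρ • e := by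
  have huu : ⟪u, u⟫ = 1 := by rw [real_inner_self_eq_norm_sq, hu, one_pow]
  have normalize : ∀ w : EuclideanSpace ℝ (Fin n), w ≠ 0 → ⟪u, w⟫ = 0 →
      ‖(‖w‖⁻¹ • w)‖ = 1 ∧ ⟪u, ‖w‖⁻¹ • w⟫ = 0 := fun w hw h =>
    ⟨by rw [norm_smul, norm_inv, norm_norm, inv_mul_cancel₀ (norm_ne_zero_iff.2 hw)],
      by rw [inner_smul_right, h, mul_zero]⟩
  by_cases hξ : ξ - ⟪u, ξ⟫ • u = 0
  · have hfin := Submodule.finrank_add_finrank_orthogonal (𝕜 := ℝ) (Submodule.span ℝ {u})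
    rw [finrank_span_singleton (by rintro rfl; simp at hu), finrank_euclideanSpace_fin] at hfin
    have : Nontrivial (Submodule.span ℝ {u})ᗮ :=
      Module.nontrivial_of_finrank_pos (R := ℝ) (by omega)
    obtain ⟨⟨w, hw⟩, hw0⟩ := exists_ne (0 : (Submodule.span ℝ {u})ᗮ)
    obtain ⟨h1, h2⟩ := normalize w (fun h => hw0 (Subtype.ext h))
      (Submodule.mem_orthogonal_singleton_iff_inner_right.1 hw)
    exact ⟨_, 0, h1, h2, by rw [zero_smul, add_zero]; exact sub_eq_zero.1 hξ⟩
  · obtain ⟨h1, h2⟩ := normalize _ hξ (by rw [inner_sub_right, inner_smul_right, huu]; ring)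
    refine ⟨_, ‖ξ - ⟪u, ξ⟫ • u‖, h1, h2, ?_⟩
    rw [smul_inv_smul₀ (norm_ne_zero_iff.2 hξ)]
    abel

theorem integrable_ite_inner {n : ℕ} {G : Type*} [NormedAddCommGroup G]
    {f : sphere (0 : EuclideanSpace ℝ (Fin n)) 1 → G} (hf : Continuous f) (s : ℝ)
    (u : EuclideanSpace ℝ (Fin n)) :
    Integrable (fun v : sphere (0 : EuclideanSpace ℝ (Fin n)) 1 =>
      if s ≤ ⟪u, v.1⟫ then f v else 0) (sphereMeasure n) :=
  (hf.integrable_of_hasCompactSupport (HasCompactSupport.of_compactSpace _)).indicator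
    (isClosed_le continuous_const (by fun_prop :
      Continuous fun v : sphere (0 : EuclideanSpace ℝ (Fin n)) 1 => ⟪u, v.1⟫)).measurableSet

/-- The moments of the cap `{v | s ≤ v i}`. -/
noncomputable def capMoment {n : ℕ} (i j : Fin n) (s : ℝ) (p m : ℕ) : ℝ :=
  ∫ v : sphere (0 : EuclideanSpace ℝ (Fin n)) 1,
    (if s ≤ ⟪EuclideanSpace.single i (1 : ℝ), v.1⟫ then v.1 i ^ p * v.1 j ^ m else 0)
      ∂(sphereMeasure n)

theorem capMoment_odd {n : ℕ} {i j : Fin n} (hij : i ≠ j) (s : ℝ) (p : ℕ) {m : ℕ} (hm : Odd m) :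
    capMoment i j s p m = 0 := by
  obtain ⟨L, hLi, hLj⟩ := exists_linearIsometryEquiv_map_pair hij
    (u := EuclideanSpace.single i 1) (e := -EuclideanSpace.single j 1) (by simp) (by simp)
    (by rw [inner_neg_right, inner_single_one]; simp [hij])
  have h : ∀ l v, v l = ⟪(EuclideanSpace.single l (1 : ℝ) : EuclideanSpace ℝ (Fin n)), v⟫ :=
    fun l v => (inner_single_one l v).symm
  have hi : ∀ v, L v i = v i := fun v => by
    rw [h i (L v)]
    nth_rw 1 [← hLi]
    rw [L.inner_map_map, ← h]
  have hj : ∀ v, L v j = -v j := fun v => by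
    rw [h j (L v), ← neg_neg (EuclideanSpace.single j (1 : ℝ)), ← hLj, inner_neg_left,
      L.inner_map_map, ← h]
  have key := integral_comp_linearIsometryEquiv L (fun v =>
    (if s ≤ ⟪EuclideanSpace.single i (1 : ℝ), v⟫ then v i ^ p * v j ^ m else 0))
  have : capMoment i j s p m = -capMoment i j s p m := by
    nth_rw 1 [capMoment]
    rw [← key, capMoment, ← integral_neg]
    refine integral_congr_ae (Filter.Eventually.of_forall fun v => ?_)
    simp only [← h, hi, hj, hm.neg_pow]
    split_ifs <;> ring
  linarith

/-- The Funk--Hecke formula for powers of real linear forms. -/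
theorem integral_cap_inner_pow {n : ℕ} (hn : 2 ≤ n) {i j : Fin n} (hij : i ≠ j) (s : ℝ) (k : ℕ)
    {u : EuclideanSpace ℝ (Fin n)} (hu : ‖u‖ = 1) (ξ : EuclideanSpace ℝ (Fin n)) :
    ∫ v : sphere (0 : EuclideanSpace ℝ (Fin n)) 1,
      (if s ≤ ⟪u, v.1⟫ then ⟪ξ, v.1⟫ ^ k else 0) ∂(sphereMeasure n) =
    ∑ m ∈ Finset.range (k + 1), (k.choose m) * ⟪u, ξ⟫ ^ (k - m) *
      (‖ξ‖ ^ 2 - ⟪u, ξ⟫ ^ 2) ^ (m / 2) * capMoment i j s (k - m) m := by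
  obtain ⟨e, ρ, he, hue, hξ⟩ := exists_unit_orthogonal_decomposition hn hu ξ
  set c := ⟪u, ξ⟫ with hc
  have hρ : ‖ξ‖ ^ 2 - c ^ 2 = ρ ^ 2 := by
    rw [hξ, norm_add_sq_real, norm_smul, norm_smul, real_inner_smul_left, real_inner_smul_right,
      hu, he, hue, mul_one, mul_one, Real.norm_eq_abs, Real.norm_eq_abs, sq_abs, sq_abs]
    ring
  obtain ⟨L, hLi, hLj⟩ := exists_linearIsometryEquiv_map_pair hij hu he hue
  rw [← integral_comp_linearIsometryEquiv L (fun v => if s ≤ ⟪u, v⟫ then ⟪ξ, v⟫ ^ k else 0)]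
  have h1 : ∀ v, ⟪u, L v⟫ = ⟪EuclideanSpace.single i (1 : ℝ), v⟫ := fun v => by
    rw [← hLi, L.inner_map_map]
  have h2 : ∀ v, ⟪e, L v⟫ = v j := fun v => by
    rw [← hLj, L.inner_map_map, inner_single_one]
  have h3 : ∀ v, ⟪ξ, L v⟫ = ρ * v j + c * v i := fun v => by
    rw [hξ, inner_add_left, real_inner_smul_left, real_inner_smul_left, h1, h2,
      inner_single_one, add_comm]
  have hexp : ∀ v : sphere (0 : EuclideanSpace ℝ (Fin n)) 1,
      (if s ≤ ⟪u, L v⟫ then ⟪ξ, L v⟫ ^ k else 0) =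
      ∑ m ∈ Finset.range (k + 1), (k.choose m * c ^ (k - m) * ρ ^ m) *
        (if s ≤ ⟪EuclideanSpace.single i (1 : ℝ), v.1⟫ then v.1 i ^ (k - m) * v.1 j ^ m else 0) := by
    intro v
    rw [h1, h3]
    split_ifs
    · rw [add_pow]
      exact Finset.sum_congr rfl fun m _ => by ring
    · simp
  simp only [hexp]
  rw [integral_finsetSum]
  · refine Finset.sum_congr rfl fun m _ => ?_
    rw [integral_const_mul, ← capMoment, hρ]
    rcases Nat.even_or_odd m with hm | hm
    · rw [← pow_mul, Nat.two_mul_div_two_of_even hm]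
    · rw [capMoment_odd hij s _ hm, mul_zero, mul_zero]
  · intro m _
    exact (integrable_ite_inner (by fun_prop) s _).const_mul _

/-- The Funk--Hecke formula for the spherical harmonic `(v i + √-1 v j) ^ k`. -/
theorem exists_integral_cap_pow_eq {n : ℕ} (hn : 2 ≤ n) {i j : Fin n} (hij : i ≠ j) (s : ℝ)
    (k : ℕ) :
    ∃ c : ℝ, ∀ u : EuclideanSpace ℝ (Fin n), ‖u‖ = 1 →
      ∫ v : sphere (0 : EuclideanSpace ℝ (Fin n)) 1,
        (if s ≤ ⟪u, v.1⟫ then ((v.1 i : ℂ) + Complex.I * v.1 j) ^ k else 0) ∂(sphereMeasure n) =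
      c * ((u i : ℂ) + Complex.I * u j) ^ k := by
  refine ⟨∑ m ∈ Finset.range (k + 1), (k.choose m) * (-1) ^ (m / 2) * capMoment i j s (k - m) m,
    fun u hu => ?_⟩
  let f : ℂ → ℂ := fun τ => ∫ v : sphere (0 : EuclideanSpace ℝ (Fin n)) 1,
    (if s ≤ ⟪u, v.1⟫ then ((v.1 i : ℂ) + τ * v.1 j) ^ k else 0) ∂(sphereMeasure n)
  let g : ℂ → ℂ := fun τ => ∑ m ∈ Finset.range (k + 1), (k.choose m) *
    ((u i : ℂ) + τ * u j) ^ (k - m) *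
      ((1 + τ ^ 2) - ((u i : ℂ) + τ * u j) ^ 2) ^ (m / 2) * capMoment i j s (k - m) m
  have hf : f = fun τ => ∑ m ∈ Finset.range (k + 1), τ ^ (k - m) *
      ∫ v : sphere (0 : EuclideanSpace ℝ (Fin n)) 1,
        (if s ≤ ⟪u, v.1⟫ then (v.1 i : ℂ) ^ m * (v.1 j : ℂ) ^ (k - m) * k.choose m else 0)
          ∂(sphereMeasure n) := by
    funext τ
    simp only [f, ← integral_const_mul]
    rw [← integral_finsetSum]
    · refine integral_congr_ae (Filter.Eventually.of_forall fun v => ?_)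
      simp only
      split_ifs
      · rw [add_pow]
        exact Finset.sum_congr rfl fun m _ => by ring
      · simp
    · intro m _
      exact (integrable_ite_inner (by fun_prop) s u).const_mul _
  have hfd : Differentiable ℂ f := by rw [hf]; fun_prop
  have hgd : Differentiable ℂ g := by fun_prop
  have hreal : ∀ t : ℝ, f t = g t := by
    intro t
    have h := integral_cap_inner_pow hn hij s k hu
      (EuclideanSpace.single i (1 : ℝ) + t • EuclideanSpace.single j (1 : ℝ))
    have hnorm : ‖(EuclideanSpace.single i (1 : ℝ) + t • EuclideanSpace.single j (1 : ℝ) :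
        EuclideanSpace ℝ (Fin n))‖ ^ 2 = 1 + t ^ 2 := by
      rw [norm_add_sq_real, norm_smul, real_inner_smul_right, inner_single_one]
      simp [hij]
    have hin : ∀ v : EuclideanSpace ℝ (Fin n), ⟪(EuclideanSpace.single i (1 : ℝ) +
        t • EuclideanSpace.single j (1 : ℝ) : EuclideanSpace ℝ (Fin n)), v⟫ = v i + t * v j := by
      intro v
      rw [inner_add_left, real_inner_smul_left, inner_single_one, inner_single_one]
    rw [real_inner_comm, hnorm] at h
    simp only [hin] at h
    have h' := congrArg (fun x : ℝ => (x : ℂ)) h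
    simp only [← integral_complex_ofReal] at h'
    simp only [f, g]
    push_cast at h'
    rw [← h']
    refine integral_congr_ae (Filter.Eventually.of_forall fun v => ?_)
    simp only
    split_ifs <;> push_cast <;> rfl
  have hfg : f = g := by
    refine AnalyticOnNhd.eq_of_frequently_eq (z₀ := 0)
      (fun x _ => hfd.analyticAt x) (fun x _ => hgd.analyticAt x) ?_
    have ht : Filter.Tendsto (fun t : ℝ => (t : ℂ)) (nhdsWithin 0 {0}ᶜ)
        (nhdsWithin 0 {0}ᶜ) := by
      refine tendsto_nhdsWithin_of_tendsto_nhds_of_eventually_within _ ?_ ?_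
      · exact (Complex.continuous_ofReal.tendsto' 0 0 (by simp)).mono_left nhdsWithin_le_nhds
      · filter_upwards [self_mem_nhdsWithin] with t ht
        simpa using ht
    exact ht.frequently (Filter.Frequently.of_forall hreal)
  have hI := congrFun hfg Complex.I
  refine hI.trans ?_
  push_cast
  rw [Finset.sum_mul]
  refine Finset.sum_congr rfl fun m hm => ?_
  rcases Nat.even_or_odd m with ⟨l, rfl⟩ | hm'
  · have hl : l + l ≤ k := by simpa [Nat.lt_succ_iff] using hm
    rw [Complex.I_sq, show (l + l) / 2 = l by omega, add_neg_cancel, zero_sub, neg_pow, ← pow_mul]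
    have hk : ∀ z : ℂ, z ^ k = z ^ (k - (l + l)) * z ^ (2 * l) := fun z => by
      rw [← pow_add, show k - (l + l) + 2 * l = k by omega]
    rw [hk]
    ring
  · rw [capMoment_odd hij s _ hm']
    simp

theorem hasDerivAt_max_zero_pow (m : ℕ) (x : ℝ) :
    HasDerivAt (fun t : ℝ => max t 0 ^ (m + 2)) ((m + 2) * max x 0 ^ (m + 1)) x := by
  have hpow : HasDerivAt (fun t : ℝ => t ^ (m + 2)) ((m + 2) * x ^ (m + 1)) x := by
    simpa using hasDerivAt_pow (m + 2) x
  have hle : ∀ t : ℝ, t ≤ 0 → max t 0 ^ (m + 2) = 0 := fun t ht => by simp [ht]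
  have hge : ∀ t : ℝ, 0 ≤ t → max t 0 ^ (m + 2) = t ^ (m + 2) := fun t ht => by simp [ht]
  rcases lt_trichotomy x 0 with hx | rfl | hx
  · rw [max_eq_right hx.le]
    refine ((hasDerivAt_const x (0 : ℝ)).congr_deriv (by simp)).congr_of_eventuallyEq ?_
    filter_upwards [Iio_mem_nhds hx] with t ht using hle t (le_of_lt ht)
  · have h1 : HasDerivWithinAt (fun t : ℝ => max t 0 ^ (m + 2)) ((m + 2) * max 0 0 ^ (m + 1))
        (Set.Iic 0) 0 :=
      ((hasDerivWithinAt_const (0 : ℝ) _ (0 : ℝ)).congr_deriv (by simp)).congr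
        (fun t ht => hle t ht) (hle 0 le_rfl)
    have h2 : HasDerivWithinAt (fun t : ℝ => max t 0 ^ (m + 2)) ((m + 2) * max 0 0 ^ (m + 1))
        (Set.Ici 0) 0 :=
      (hpow.hasDerivWithinAt.congr_deriv (by simp)).congr
        (fun t ht => hge t ht) (hge 0 le_rfl)
    have h3 := h1.union h2
    rwa [Set.Iic_union_Ici, hasDerivWithinAt_univ] at h3
  · rw [max_eq_left hx.le]
    refine hpow.congr_of_eventuallyEq ?_
    filter_upwards [Ioi_mem_nhds hx] with t ht using hge t (le_of_lt ht)

/-- The quadratic inequality behind the positivity of the image of the test function. -/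
theorem bracket_pos {n N a b t P : ℝ} (hn : 0 ≤ n) (hN1 : 1 ≤ N) (ha : 0 < a) (hb : b < 1)
    (hat : a < t) (htb : t < b) (hP : 0 ≤ P)
    (hN : (60 + 4 * n) ^ 2 < N * (12 * (1 - b ^ 2) * (b - a) ^ 2)) :
    0 < 2 * N * (2 * N + n) * P ^ 2 + (1 - t ^ 2) * (12 * (b - a) ^ 2 - 56 * P) -
      4 * (n + 1) * (t * (a + b - 2 * t)) * P := by
  have hK : N * P ^ 2 ≤ 2 * N * (2 * N + n) * P ^ 2 := by
    refine mul_le_mul_of_nonneg_right ?_ (sq_nonneg P)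
    nlinarith [mul_nonneg (by linarith : 0 ≤ N) hn]
  have h1 : 12 * (1 - b ^ 2) * (b - a) ^ 2 ≤ (1 - t ^ 2) * (12 * (b - a) ^ 2) := by
    have : t ^ 2 ≤ b ^ 2 := pow_le_pow_left₀ (by linarith) htb.le 2
    linarith [mul_nonneg (sub_nonneg.2 this) (sq_nonneg (b - a))]
  have h2 : (1 - t ^ 2) * (56 * P) ≤ 56 * P := by linarith [mul_nonneg (sq_nonneg t) hP]
  have h3 : t * (a + b - 2 * t) ≤ 1 := by nlinarith
  have h4 : (n + 1) * P * (t * (a + b - 2 * t)) ≤ (n + 1) * P * 1 :=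
    mul_le_mul_of_nonneg_left h3 (by positivity)
  generalize 12 * (1 - b ^ 2) * (b - a) ^ 2 = c at hN h1
  have h5 : 0 < N * P ^ 2 - (60 + 4 * n) * P + c := by
    have h : 4 * N * (N * P ^ 2 - (60 + 4 * n) * P + c) =
        (2 * N * P - (60 + 4 * n)) ^ 2 + (4 * (N * c) - (60 + 4 * n) ^ 2) := by ring
    have h' : 0 < 4 * N * (N * P ^ 2 - (60 + 4 * n) * P + c) := by
      rw [h]
      linarith [sq_nonneg (2 * N * P - (60 + 4 * n)), sq_nonneg (60 + 4 * n)]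
    exact pos_of_mul_pos_right h' (by linarith)
  linarith

/-- A zonal test function, supported near the parallels with heights in `[a, b]`, whose image under
the shifted spherical Laplacian is increasing. -/
theorem exists_test_function (n : ℕ) {a b : ℝ} (ha : 0 < a) (hab : a < b) (hb : b < 1) :
    ∃ (m : ℕ) (ψ φ φ' g : ℝ → ℝ), Even m ∧ (∀ x, HasDerivAt ψ (φ x) x) ∧
      (∀ x, HasDerivAt φ (φ' x) x) ∧ Continuous φ' ∧ Continuous g ∧
      (∀ x, HasDerivAt (fun t => (m + 1) * (m + n - 1) * ψ t + (1 - t ^ 2) * φ' t -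
        (n - 1) * t * φ t) (g x) x) ∧
      ψ (-1) = 0 ∧ φ (-1) = 0 ∧ (∀ t, 0 ≤ g t) ∧ (∀ t ∉ Set.Ioo a b, g t = 0) ∧
      ∀ t ∈ Set.Ioo a b, 0 < g t := by
  have hc0 : 0 < 12 * (1 - b ^ 2) * (b - a) ^ 2 := by
    have : 0 < 1 - b ^ 2 := by nlinarith
    have : 0 < b - a := by linarith
    positivity
  obtain ⟨N, hN⟩ := exists_nat_gt ((60 + 4 * (n : ℝ)) ^ 2 / (12 * (1 - b ^ 2) * (b - a) ^ 2))
  rw [div_lt_iff₀ hc0] at hN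
  set p : ℝ → ℝ := fun t => max ((t - a) * (b - t)) 0 with hp
  have hpow : ∀ (l : ℕ) (x : ℝ), HasDerivAt (fun t => p t ^ (l + 2))
      ((l + 2) * p x ^ (l + 1) * (a + b - 2 * x)) x := by
    intro l x
    have h1 : HasDerivAt (fun t : ℝ => (t - a) * (b - t)) (a + b - 2 * x) x := by
      refine (((hasDerivAt_id x).sub_const a).mul ((hasDerivAt_id x).const_sub b)).congr_deriv ?_
      simp only [id]
      ring
    exact (hasDerivAt_max_zero_pow l ((x - a) * (b - x))).comp x h1
  have hpc : Continuous p := by fun_prop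
  set φ : ℝ → ℝ := fun t => p t ^ 4 with hφ
  set φ' : ℝ → ℝ := fun t => 4 * p t ^ 3 * (a + b - 2 * t) with hφ'
  set φ'' : ℝ → ℝ := fun t => 12 * p t ^ 2 * (a + b - 2 * t) ^ 2 - 8 * p t ^ 3 with hφ''
  have hφc : Continuous φ := by fun_prop
  set ψ : ℝ → ℝ := fun t => ∫ x in (-1 : ℝ)..t, φ x with hψ
  have dψ : ∀ x, HasDerivAt ψ (φ x) x := fun x =>
    intervalIntegral.integral_hasDerivAt_right (hφc.intervalIntegrable _ _)
      hφc.aestronglyMeasurable.stronglyMeasurableAtFilter hφc.continuousAt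
  have dφ : ∀ x, HasDerivAt φ (φ' x) x := fun x => by
    refine (hpow 2 x).congr_deriv ?_
    simp only [hφ']
    push_cast
    ring
  have dφ' : ∀ x, HasDerivAt φ' (φ'' x) x := fun x => by
    have h1 : HasDerivAt (fun t : ℝ => a + b - 2 * t) (-2) x := by
      simpa using ((hasDerivAt_id x).const_mul 2).const_sub (a + b)
    refine (((hpow 1 x).const_mul 4).mul h1).congr_deriv ?_
    simp only [hφ'']
    push_cast
    ring
  have hp1 : ∀ t ∉ Set.Ioo a b, p t = 0 := by
    intro t ht
    refine max_eq_right ?_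
    rcases le_or_gt t a with h | h
    · nlinarith
    · have : b ≤ t := not_lt.1 fun h' => ht ⟨h, h'⟩
      nlinarith
  set m : ℕ := 2 * N with hm
  set g : ℝ → ℝ := fun t => (m + 1) * (m + n - 1) * φ t + (1 - t ^ 2) * φ'' t - 2 * t * φ' t -
    (n - 1) * φ t - (n - 1) * t * φ' t with hg
  have hg0 : ∀ t ∉ Set.Ioo a b, g t = 0 := by
    intro t ht
    simp [hg, hφ, hφ', hφ'', hp1 t ht]
  have hgpos : ∀ t ∈ Set.Ioo a b, 0 < g t := by
    rintro t ⟨hat, htb⟩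
    have hpt : p t = (t - a) * (b - t) := max_eq_left (by nlinarith)
    have hpt0 : 0 < p t := by rw [hpt]; nlinarith
    have hq : (a + b - 2 * t) ^ 2 = (b - a) ^ 2 - 4 * p t := by rw [hpt]; ring
    have hgt : g t = p t ^ 2 * (m * (m + n) * p t ^ 2 +
        (1 - t ^ 2) * (12 * (b - a) ^ 2 - 56 * p t) -
        4 * (n + 1) * (t * (a + b - 2 * t)) * p t) := by
      simp only [hg, hφ, hφ', hφ'', hq]
      ring
    rw [hgt]
    refine mul_pos (by positivity) ?_
    have hNpos : 0 < N := by
      refine Nat.pos_of_ne_zero fun h => ?_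
      rw [h, Nat.cast_zero, zero_mul] at hN
      exact absurd hN (not_lt.2 (sq_nonneg _))
    have hmN : (m : ℝ) = 2 * N := by simp [hm]
    rw [hmN]
    exact bracket_pos (Nat.cast_nonneg n) (by exact_mod_cast hNpos) ha hb hat htb hpt0.le hN
  refine ⟨m, ψ, φ, φ', g, ⟨N, by omega⟩, dψ, dφ, by fun_prop, by fun_prop, fun x => ?_, ?_, ?_, ?_,
    hg0, hgpos⟩
  · have d1 : HasDerivAt (fun t : ℝ => 1 - t ^ 2) (-(2 * x)) x := by
      simpa using (hasDerivAt_pow 2 x).const_sub 1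
    have d2 : HasDerivAt (fun t : ℝ => ((n : ℝ) - 1) * t) (n - 1) x := by
      simpa using (hasDerivAt_id x).const_mul ((n : ℝ) - 1)
    refine ((((dψ x).const_mul (((m : ℝ) + 1) * (m + n - 1))).add (d1.mul (dφ' x))).sub
      (d2.mul (dφ x))).congr_deriv ?_
    simp only [hg]
    ring
  · simp [hψ]
  · simp [hφ, hp1 (-1) (fun h => by linarith [h.1])]
  · intro t
    by_cases ht : t ∈ Set.Ioo a b
    · exact (hgpos t ht).le
    · exact (hg0 t ht).ge

/-- The Funk--Hecke multiplier of the cap transform. -/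
noncomputable def capMultiplier {n : ℕ} (i j : Fin n) (k : ℕ) (s : ℝ) : ℝ :=
  ∫ v : sphere (0 : EuclideanSpace ℝ (Fin n)) 1,
    (if s ≤ v.1 i then (((v.1 i : ℂ) + v.1 j * Complex.I) ^ k).re else 0) ∂(sphereMeasure n)

theorem measurableSet_le_coord {n : ℕ} (i : Fin n) (s : ℝ) :
    MeasurableSet {v : sphere (0 : EuclideanSpace ℝ (Fin n)) 1 | s ≤ v.1 i} :=
  (isClosed_le continuous_const (by fun_prop)).measurableSet

theorem continuousAt_capMultiplier {n : ℕ} {i j : Fin n} (hij : i ≠ j) (k : ℕ) {s : ℝ}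
    (hs : s ^ 2 < 1) : ContinuousAt (capMultiplier i j k) s := by
  have hf : Continuous fun v : sphere (0 : EuclideanSpace ℝ (Fin n)) 1 =>
    (((v.1 i : ℂ) + v.1 j * Complex.I) ^ k).re := by fun_prop
  refine continuousAt_of_dominated
    (bound := fun v => ‖(((v.1 i : ℂ) + v.1 j * Complex.I) ^ k).re‖)
    (Filter.Eventually.of_forall fun t =>
      (hf.measurable.ite (measurableSet_le_coord i t) measurable_const).aestronglyMeasurable)
    (Filter.Eventually.of_forall fun t => Filter.Eventually.of_forall fun v => ?_)
    (hf.integrable_of_hasCompactSupport (HasCompactSupport.of_compactSpace _)).norm ?_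
  · split_ifs
    · exact le_rfl
    · simp
  · have h0 : ∀ᵐ v ∂(sphereMeasure n), v.1 i ≠ s := by
      rw [ae_iff]
      simpa using sphereMeasure_parallel hij hs
    filter_upwards [h0] with v hv
    rcases lt_or_gt_of_ne hv with h | h
    · refine continuousAt_const.congr (f := fun _ => (0 : ℝ)) ?_
      filter_upwards [Ioi_mem_nhds h] with t ht
      rw [if_neg (not_le.2 ht)]
    · refine continuousAt_const.congr
        (f := fun _ => (((v.1 i : ℂ) + v.1 j * Complex.I) ^ k).re) ?_
      filter_upwards [Iio_mem_nhds h] with t ht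
      rw [if_pos (le_of_lt ht)]

theorem integrable_mul_capMultiplier_kernel {n : ℕ} (i j : Fin n) (k : ℕ) {g : ℝ → ℝ}
    (hg : Continuous g) :
    Integrable (fun q : ℝ × sphere (0 : EuclideanSpace ℝ (Fin n)) 1 =>
      if q.1 ≤ q.2.1 i then g q.1 * (((q.2.1 i : ℂ) + q.2.1 j * Complex.I) ^ k).re else 0)
      ((volume.restrict (Set.Ioc (-1) 1)).prod (sphereMeasure n)) := by
  have hf : Continuous fun v : sphere (0 : EuclideanSpace ℝ (Fin n)) 1 =>
    (((v.1 i : ℂ) + v.1 j * Complex.I) ^ k).re := by fun_prop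
  have h1 : IntegrableOn g (Set.Ioc (-1) 1) :=
    (hg.continuousOn.integrableOn_Icc).mono_set Set.Ioc_subset_Icc_self
  have h2 : Integrable (fun v : sphere (0 : EuclideanSpace ℝ (Fin n)) 1 =>
    (((v.1 i : ℂ) + v.1 j * Complex.I) ^ k).re) (sphereMeasure n) :=
    hf.integrable_of_hasCompactSupport (HasCompactSupport.of_compactSpace _)
  exact (Integrable.mul_prod h1 h2).indicator (isClosed_le continuous_fst (by fun_prop :
    Continuous fun q : ℝ × sphere (0 : EuclideanSpace ℝ (Fin n)) 1 => q.2.1 i)).measurableSet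

theorem integral_mul_capMultiplier {n : ℕ} (i j : Fin n) (k : ℕ) {G g : ℝ → ℝ}
    (hG : ∀ x, HasDerivAt G (g x) x) (hg : Continuous g) (hG0 : G (-1) = 0) :
    ∫ s in Set.Ioc (-1 : ℝ) 1, g s * capMultiplier i j k s =
      ∫ v : sphere (0 : EuclideanSpace ℝ (Fin n)) 1,
        G (v.1 i) * (((v.1 i : ℂ) + v.1 j * Complex.I) ^ k).re ∂(sphereMeasure n) := by
  have h1 : ∀ s, g s * capMultiplier i j k s =
      ∫ v : sphere (0 : EuclideanSpace ℝ (Fin n)) 1,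
        (if s ≤ v.1 i then g s * (((v.1 i : ℂ) + v.1 j * Complex.I) ^ k).re else 0)
          ∂(sphereMeasure n) := by
    intro s
    rw [capMultiplier, ← integral_const_mul]
    simp only [mul_ite, mul_zero]
  simp only [h1]
  rw [integral_integral_swap (f := fun s (v : sphere (0 : EuclideanSpace ℝ (Fin n)) 1) =>
    if s ≤ v.1 i then g s * (((v.1 i : ℂ) + v.1 j * Complex.I) ^ k).re else 0)
    (integrable_mul_capMultiplier_kernel i j k hg)]
  refine integral_congr_ae (Filter.Eventually.of_forall fun v => ?_)
  have hv : |v.1 i| ≤ 1 := by simpa using PiLp.norm_apply_le v.1 i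
  rw [abs_le] at hv
  have h2 : (fun s => if s ≤ v.1 i then g s * (((v.1 i : ℂ) + v.1 j * Complex.I) ^ k).re else 0) =
      (Set.Iic (v.1 i)).indicator
        fun s => g s * (((v.1 i : ℂ) + v.1 j * Complex.I) ^ k).re := rfl
  simp only [h2]
  rw [setIntegral_indicator measurableSet_Iic, Set.Ioc_inter_Iic, min_eq_right hv.2,
    integral_mul_const, ← intervalIntegral.integral_of_le hv.1,
    intervalIntegral.integral_eq_sub_of_hasDerivAt (fun x _ => hG x)
      (hg.intervalIntegrable _ _), hG0, sub_zero]

/-- The multipliers of odd degree have a zero in every interval. -/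
theorem exists_capMultiplier_eq_zero {n : ℕ} {i j : Fin n} (hij : i ≠ j) {a b : ℝ}
    (ha : 0 < a) (hab : a < b) (hb : b < 1) :
    ∃ k, Odd k ∧ ∃ s ∈ Set.Ioo a b, capMultiplier i j k s = 0 := by
  obtain ⟨m, ψ, φ, φ', g, hm, dψ, dφ, hφ', hg, dG, hψ1, hφ1, hg0, hgz, hgpos⟩ :=
    exists_test_function n ha hab hb
  refine ⟨m + 1, hm.add_one, ?_⟩
  by_contra! hne
  set c := capMultiplier i j (m + 1) with hc
  have hcont : ContinuousOn c (Set.Ioo a b) := fun s hs =>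
    (continuousAt_capMultiplier hij (m + 1) (by nlinarith [hs.1, hs.2])).continuousWithinAt
  have hI : ∫ s in Set.Ioc (-1 : ℝ) 1, g s * c s = 0 := by
    rw [hc, integral_mul_capMultiplier i j (m + 1) dG hg (by rw [hψ1, hφ1]; ring)]
    have h := congrArg Complex.re (integral_laplacian_zonal_mul hij dψ dφ hφ' m)
    have hφc : Continuous φ := continuous_iff_continuousAt.2 fun x => (dφ x).continuousAt
    have hψc : Continuous ψ := continuous_iff_continuousAt.2 fun x => (dψ x).continuousAt
    rw [← RCLike.re_eq_complex_re, ← integral_re] at h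
    · refine Eq.trans ?_ h
      refine integral_congr_ae (Filter.Eventually.of_forall fun v => ?_)
      simp only [zonalMulPow, RCLike.re_eq_complex_re, Complex.re_ofReal_mul]
    · exact integrable_sphere (continuous_zonalMulPow i j (by fun_prop) _)
  have hint : IntegrableOn (fun s => g s * c s) (Set.Ioc (-1) 1) := by
    refine (integrable_mul_capMultiplier_kernel i j (m + 1) hg).integral_prod_left.congr
      (Filter.Eventually.of_forall fun s => ?_)
    simp only [hc, capMultiplier]
    rw [← integral_const_mul]
    simp only [mul_ite, mul_zero]
  have hsign : ∃ ε : ℝ, ∀ s ∈ Set.Ioo a b, 0 < ε * c s := by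
    have hmid : (a + b) / 2 ∈ Set.Ioo a b := ⟨by linarith, by linarith⟩
    have hoc := (isPreconnected_Ioo.image c hcont).ordConnected
    rcases lt_or_gt_of_ne (hne _ hmid) with h | h
    · refine ⟨-1, fun s hs => ?_⟩
      by_contra hcs
      obtain ⟨t, ht, ht0⟩ := hoc.out (Set.mem_image_of_mem c hmid) (Set.mem_image_of_mem c hs)
        (⟨h.le, by linarith⟩ : (0 : ℝ) ∈ Set.Icc _ _)
      exact hne t ht ht0
    · refine ⟨1, fun s hs => ?_⟩
      by_contra hcs
      obtain ⟨t, ht, ht0⟩ := hoc.out (Set.mem_image_of_mem c hs) (Set.mem_image_of_mem c hmid)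
        (⟨by linarith, h.le⟩ : (0 : ℝ) ∈ Set.Icc _ _)
      exact hne t ht ht0
  obtain ⟨ε, hε⟩ := hsign
  have hnonneg : ∀ s, 0 ≤ ε * (g s * c s) := by
    intro s
    by_cases hs : s ∈ Set.Ioo a b
    · have := mul_pos (hgpos s hs) (hε s hs)
      nlinarith
    · rw [hgz s hs, zero_mul, mul_zero]
  have hzero := (integral_eq_zero_iff_of_nonneg hnonneg (hint.const_mul ε)).1
    (by rw [integral_const_mul, hI, mul_zero])
  have hsub : Set.Ioo a b ⊆ {s | ¬ (ε * (g s * c s) = 0)} := fun s hs => by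
    have := mul_pos (hgpos s hs) (hε s hs)
    have h' : 0 < ε * (g s * c s) := by nlinarith
    exact h'.ne'
  have hnull : (volume.restrict (Set.Ioc (-1 : ℝ) 1)) (Set.Ioo a b) = 0 :=
    measure_mono_null hsub (ae_iff.1 hzero)
  have hinter : Set.Ioo a b ∩ Set.Ioc (-1 : ℝ) 1 = Set.Ioo a b :=
    Set.inter_eq_left.2 fun s hs => ⟨by linarith [hs.1], by linarith [hs.2]⟩
  rw [Measure.restrict_apply measurableSet_Ioo, hinter, Real.volume_Ioo,
    ENNReal.ofReal_eq_zero] at hnull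
  linarith

theorem setIntegral_cap_eq_zero {n : ℕ} (hn : 2 ≤ n) {i j : Fin n} (hij : i ≠ j) {k : ℕ} {s : ℝ}
    (h : capMultiplier i j k s = 0) (u : sphere (0 : EuclideanSpace ℝ (Fin n)) 1) :
    ∫ v in cap n s u, (((v.1 i : ℂ) + Complex.I * v.1 j) ^ k).re ∂(sphereMeasure n) = 0 := by
  obtain ⟨c, hc⟩ := exists_integral_cap_pow_eq hn hij s k
  have hre : ∀ u : EuclideanSpace ℝ (Fin n),
      ∫ v : sphere (0 : EuclideanSpace ℝ (Fin n)) 1,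
        (if s ≤ ⟪u, v.1⟫ then (((v.1 i : ℂ) + Complex.I * v.1 j) ^ k).re else 0)
          ∂(sphereMeasure n) =
      (∫ v : sphere (0 : EuclideanSpace ℝ (Fin n)) 1,
        (if s ≤ ⟪u, v.1⟫ then ((v.1 i : ℂ) + Complex.I * v.1 j) ^ k else 0)
          ∂(sphereMeasure n)).re := by
    intro u
    rw [← RCLike.re_eq_complex_re, ← integral_re (integrable_ite_inner (by fun_prop) s u)]
    refine integral_congr_ae (Filter.Eventually.of_forall fun v => ?_)
    simp only [RCLike.re_eq_complex_re]
    split_ifs <;> simp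
  have hc0 : c = 0 := by
    have h1 := hre (EuclideanSpace.single i 1)
    rw [hc _ (by simp)] at h1
    simp only [inner_single_one] at h1
    simp only [capMultiplier, mul_comm _ Complex.I] at h
    rw [h] at h1
    simpa [hij.symm] using h1.symm
  have hmeas : MeasurableSet (cap n s u) :=
    (isClosed_le continuous_const (by fun_prop :
      Continuous fun v : sphere (0 : EuclideanSpace ℝ (Fin n)) 1 => ⟪u.1, v.1⟫)).measurableSet
  rw [← integral_indicator hmeas]
  refine (hre u.1).trans ?_
  rw [hc u.1 (by simp), hc0]
  simp

theorem stmt4 (n : ℕ) (hn : 3 ≤ n) :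
    Set.Ioo (0 : ℝ) 1 ⊆ closure {s : ℝ | s ∈ Set.Ioo (0 : ℝ) 1 ∧
      ∃ F : sphere (0 : EuclideanSpace ℝ (Fin n)) 1 → ℝ,
        Continuous F ∧ (∀ v, F (-v) = -F v) ∧ F ≠ 0 ∧
        ∀ u : sphere (0 : EuclideanSpace ℝ (Fin n)) 1,
          ∫ v in cap n s u, F v ∂(sphereMeasure n) = 0} := by
  rintro x ⟨hx0, hx1⟩
  rw [Metric.mem_closure_iff]
  intro ε hε
  let i : Fin n := ⟨0, by omega⟩
  let j : Fin n := ⟨1, by omega⟩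
  have hij : i ≠ j := by simp [i, j]
  obtain ⟨k, hk, s, ⟨hs1, hs2⟩, hs⟩ := exists_capMultiplier_eq_zero hij
    (b := min (x + ε) ((x + 1) / 2)) hx0 (lt_min (by linarith) (by linarith))
    (min_lt_of_right_lt (by linarith))
  rw [lt_min_iff] at hs2
  refine ⟨s, ⟨⟨by linarith, by linarith⟩, fun v => (((v.1 i : ℂ) + Complex.I * v.1 j) ^ k).re,
    by fun_prop, fun v => ?_, fun h => ?_, setIntegral_cap_eq_zero (by omega) hij hs⟩, ?_⟩
  · have h : (((-v).1 i : ℂ) + Complex.I * (-v).1 j) = -((v.1 i : ℂ) + Complex.I * v.1 j) := by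
      simp
      ring
    simp only [h, hk.neg_pow, Complex.neg_re]
  · have h1 := congrFun h ⟨EuclideanSpace.single i 1, by simp⟩
    simp [hij.symm] at h1
  · rw [Real.dist_eq, abs_lt]
    constructor <;> linarith
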